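/- Let d ∈ {2,3}. There exists a constant c > 0, depending only on d, such that for all smooth 2π-periodic vector fields u, w : ℝ^d → ℝ^d with ∫_Ω w(x) dx = 0, one has | ∫_Ω ((w·∇)u)(x) · w(x) dx | ≤ c ( ∫_Ω |∇u(x)|² dx )^{1/2} ∫_Ω |∇w(x)|² dx. -/

import Mathlib

open MeasureTheory Real

noncomputable section

/-- Partial derivative in direction `i` of a scalar function on `ℝ^d`. -/
def pd {d : ℕ} (f : (Fin d → ℝ) → ℝ) (i : Fin d) (x : Fin d → ℝ) : ℝ :=
  fderiv ℝ f x (Pi.single i 1)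

/-- The periodic box `Ω = (0, 2π)^d`. -/
def box (d : ℕ) : Set (Fin d → ℝ) := Set.univ.pi fun _ => Set.Ioo 0 (2 * π)

/-- `2π`-periodicity in every coordinate direction. -/
def IsPer {d : ℕ} {E : Type*} (g : (Fin d → ℝ) → E) : Prop :=
  ∀ (x : Fin d → ℝ) (i : Fin d), g (x + Pi.single i (2 * π)) = g x

/-- Frobenius norm of a `d × d` matrix. -/
def frob {d : ℕ} (M : Fin d → Fin d → ℝ) : ℝ := Real.sqrt (∑ i, ∑ j, M i j ^ 2)

/-- Inner (double-dot) product of `d × d` matrices: `A : B = ∑ᵢⱼ Aᵢⱼ Bᵢⱼ`. -/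
def minner {d : ℕ} (A B : Fin d → Fin d → ℝ) : ℝ := ∑ i, ∑ j, A i j * B i j

/-- Symmetry of a `d × d` matrix. -/
def Symm {d : ℕ} (A : Fin d → Fin d → ℝ) : Prop := ∀ i j, A i j = A j i

/-- The gradient matrix `(∇u)ᵢⱼ = ∂ⱼuᵢ` of a vector field. -/
def gradM {d : ℕ} (u : (Fin d → ℝ) → (Fin d → ℝ)) (x : Fin d → ℝ) : Fin d → Fin d → ℝ :=
  fun i j => pd (fun y => u y i) j x

/-- The symmetric part `Du = ½(∇u + (∇u)ᵀ)` of the gradient. -/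
def symG {d : ℕ} (u : (Fin d → ℝ) → (Fin d → ℝ)) (x : Fin d → ℝ) : Fin d → Fin d → ℝ :=
  fun i j => (gradM u x i j + gradM u x j i) / 2

/-- Componentwise Laplacian `Δuᵢ = ∑ₖ ∂ₖ∂ₖ uᵢ`. -/
def lap {d : ℕ} (u : (Fin d → ℝ) → (Fin d → ℝ)) (i : Fin d) (x : Fin d → ℝ) : ℝ :=
  ∑ k, pd (pd (fun y => u y i) k) k x

/-- Divergence-free condition `div u = ∑ᵢ ∂ᵢuᵢ = 0` everywhere. -/
def DivFree {d : ℕ} (u : (Fin d → ℝ) → (Fin d → ℝ)) : Prop :=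
  ∀ x, ∑ i, pd (fun y => u y i) i x = 0

open scoped ENNReal NNReal

theorem aux_cs {α : Type*} [MeasurableSpace α] (μ : Measure α) {f g : α → ℝ≥0∞}
    (hf : AEMeasurable f μ) (hg : AEMeasurable g μ) :
    (∫⁻ a, f a * g a ∂μ) ^ 2 ≤ (∫⁻ a, f a ^ 2 ∂μ) * (∫⁻ a, g a ^ 2 ∂μ) := by
  have h := ENNReal.lintegral_mul_le_Lp_mul_Lq μ Real.HolderConjugate.two_two hf hg
  calc (∫⁻ a, f a * g a ∂μ) ^ 2 ≤ _ := pow_le_pow_left' h 2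
    _ = _ := by
      rw [mul_pow, ← ENNReal.rpow_natCast, ← ENNReal.rpow_natCast, ← ENNReal.rpow_mul,
        ← ENNReal.rpow_mul]
      norm_num

theorem aux_cs1 {α : Type*} [MeasurableSpace α] (μ : Measure α) {f : α → ℝ≥0∞}
    (hf : AEMeasurable f μ) :
    (∫⁻ a, f a ∂μ) ^ 2 ≤ μ Set.univ * (∫⁻ a, f a ^ 2 ∂μ) := by
  have := aux_cs μ (f := fun _ => 1) (g := f) aemeasurable_const hf
  simpa using this

theorem aux_shift {d : ℕ} (F : (Fin d → ℝ) → ℝ≥0∞) (hF : IsPer F) (h : Fin d → ℝ) :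
    ∫⁻ x in box d, F (h + x) = ∫⁻ x in box d, F x := by
  have hpi : (2 * π) ≠ 0 := by positivity
  set b : Module.Basis (Fin d) ℝ (Fin d → ℝ) :=
    (Pi.basisFun ℝ (Fin d)).unitsSMul (fun _ => Units.mk0 (2 * π) hpi) with hb
  have hbi : ∀ i, b i = Pi.single i (2 * π) := by
    intro i
    simp [hb, Module.Basis.unitsSMul_apply, Units.smul_def]
    rw [← Pi.single_smul]; simp
  have hfd : ZSpan.fundamentalDomain b = Set.univ.pi fun _ => Set.Ico 0 (2 * π) := by
    ext x
    have hp : 0 < 2 * π := by positivity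
    simp only [ZSpan.mem_fundamentalDomain, Set.mem_pi, Set.mem_univ, true_imp_iff, hb,
      Module.Basis.repr_unitsSMul, Pi.basisFun_repr, Units.smul_def, Set.mem_Ico, smul_eq_mul]
    refine forall_congr' fun i => ?_
    rw [Units.val_inv_eq_inv_val, Units.val_mk0, inv_mul_lt_iff₀ hp, mul_one]
    refine and_congr ⟨fun h => ?_, fun h => by positivity⟩ Iff.rfl
    by_contra! h'
    have : (2 * π)⁻¹ * x i < 0 := mul_neg_of_pos_of_neg (by positivity) h'
    linarith
  have hae : (box d) =ᵐ[volume] ZSpan.fundamentalDomain b := by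
    rw [hfd, box]
    exact (Measure.univ_pi_Ioo_ae_eq_Icc (μ := fun _ : Fin d => (volume : Measure ℝ))
      (f := fun _ => 0) (g := fun _ => 2 * π)).trans
      (Measure.univ_pi_Ico_ae_eq_Icc (μ := fun _ : Fin d => (volume : Measure ℝ))
      (f := fun _ => 0) (g := fun _ => 2 * π)).symm
  have hfund := ZSpan.isAddFundamentalDomain' b (volume : Measure (Fin d → ℝ))
  have hinv : ∀ (g : (Submodule.span ℤ (Set.range b)).toAddSubgroup) (x), F (g +ᵥ x) = F x := by
    rintro ⟨g, hg⟩ x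
    change F (g + x) = F x
    replace hg : g ∈ Submodule.span ℤ (Set.range b) := hg
    induction hg using Submodule.span_induction generalizing x with
    | mem y hy =>
      obtain ⟨i, rfl⟩ := hy
      rw [hbi, add_comm]; exact hF x i
    | zero => simp
    | add y z _ _ h1 h2 => rw [add_assoc, h1, h2]
    | smul n y _ h1 =>
      have key : ∀ n : ℤ, F (n • y + x) = F x := by
        intro n
        induction n with
        | zero => simp
        | succ n ih => rw [add_smul, one_smul, add_comm (_ • y) y, add_assoc, h1, ih]
        | pred n ih => rw [← h1, ← add_assoc, sub_smul, one_smul, add_sub_cancel, ih]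
      exact key n
  have : Countable (Submodule.span ℤ (Set.range b)).toAddSubgroup :=
    inferInstanceAs (Countable (Submodule.span ℤ (Set.range b)))
  have h2 := hfund.vadd_of_comm h
  have h3 := h2.setLIntegral_eq hfund F hinv
  rw [setLIntegral_congr hae, setLIntegral_congr hae, ← h3]
  have := (measurePreserving_add_left (volume : Measure (Fin d → ℝ)) h).setLIntegral_comp_emb
    (measurableEmbedding_addLeft h) F (ZSpan.fundamentalDomain b)
  rw [this]
  rfl

theorem aux_diff {d : ℕ} (w : (Fin d → ℝ) → (Fin d → ℝ)) (hw : ContDiff ℝ 1 w)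
    (x h : Fin d → ℝ) :
    ‖w (h + x) - w x‖ₑ ^ 2 ≤
      ‖h‖ₑ ^ 2 * ∫⁻ t in Set.Ioc (0:ℝ) 1, ‖fderiv ℝ w (t • h + x)‖ₑ ^ 2 := by
  have hc : Continuous (fun t : ℝ => fderiv ℝ w (t • h + x)) :=
    (hw.continuous_fderiv (by norm_num)).comp (by fun_prop)
  have hd : ∀ t : ℝ, HasDerivAt (fun t : ℝ => w (t • h + x)) (fderiv ℝ w (t • h + x) h) t := by
    intro t
    have h1 : HasDerivAt (fun t : ℝ => t • h + x) h t := by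
      simpa using ((hasDerivAt_id t).smul_const h).add_const x
    exact ((hw.differentiable (by norm_num) _).hasFDerivAt).comp_hasDerivAt t h1
  have hint : ∫ t in (0:ℝ)..1, fderiv ℝ w (t • h + x) h = w (h + x) - w x := by
    rw [intervalIntegral.integral_eq_sub_of_hasDerivAt (fun t _ => hd t)]
    · simp
    · exact (hc.clm_apply continuous_const).intervalIntegrable _ _
  rw [← hint, intervalIntegral.integral_of_le zero_le_one]
  calc _ ≤ (∫⁻ t in Set.Ioc (0:ℝ) 1, ‖fderiv ℝ w (t • h + x) h‖ₑ) ^ 2 :=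
        pow_le_pow_left' (enorm_integral_le_lintegral_enorm _) 2
    _ ≤ (∫⁻ t in Set.Ioc (0:ℝ) 1, ‖h‖ₑ * ‖fderiv ℝ w (t • h + x)‖ₑ) ^ 2 := by
        refine pow_le_pow_left' (lintegral_mono fun t => ?_) 2
        rw [mul_comm]
        exact ContinuousLinearMap.le_opENorm _ _
    _ ≤ (‖h‖ₑ * ∫⁻ t in Set.Ioc (0:ℝ) 1, ‖fderiv ℝ w (t • h + x)‖ₑ) ^ 2 := by
        rw [lintegral_const_mul' _ _ (by simp)]
    _ ≤ _ := by
        rw [mul_pow]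
        gcongr
        refine (aux_cs1 _ hc.enorm.measurable.aemeasurable).trans ?_
        simp

theorem aux_per_fderiv {d : ℕ} (w : (Fin d → ℝ) → (Fin d → ℝ)) (hp : IsPer w) :
    IsPer (fderiv ℝ w) := by
  intro x i
  rw [← fderiv_comp_add_right]
  congr 1
  funext y
  exact hp y i

theorem aux_box_vol (d : ℕ) : volume (box d) ≠ ∞ ∧ volume (box d) ≠ 0 := by
  have hp : 0 < 2 * π := by positivity
  rw [box, Real.volume_pi_Ioo]
  constructor
  · exact ENNReal.prod_ne_top fun i _ => ENNReal.ofReal_ne_top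
  · rw [Finset.prod_ne_zero_iff]
    intro i _
    simp [Real.pi_pos]

theorem aux_mem_box {d : ℕ} {h : Fin d → ℝ} (hh : h ∈ box d) : ‖h‖ₑ ≤ ENNReal.ofReal (2 * π) := by
  rw [← ofReal_norm]
  apply ENNReal.ofReal_le_ofReal
  rw [pi_norm_le_iff_of_nonneg (by positivity)]
  intro i
  have := hh i trivial
  rw [Real.norm_eq_abs, abs_of_pos this.1]
  exact this.2.le

theorem aux_box_meas (d : ℕ) : MeasurableSet (box d) :=
  MeasurableSet.univ_pi fun _ => measurableSet_Ioo

theorem aux_integrable {d : ℕ} {E : Type*} [NormedAddCommGroup E]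
    {f : (Fin d → ℝ) → E} (hf : Continuous f) : IntegrableOn f (box d) volume := by
  have hK : IsCompact (Set.univ.pi fun _ : Fin d => Set.Icc 0 (2 * π)) :=
    isCompact_univ_pi fun _ => isCompact_Icc
  exact (hf.continuousOn.integrableOn_compact hK).mono_set
    (Set.pi_mono fun _ _ => Set.Ioo_subset_Icc_self)

theorem aux_poincare {d : ℕ} (w : (Fin d → ℝ) → (Fin d → ℝ)) (hw : ContDiff ℝ 1 w)
    (hp : IsPer w) (h0 : ∫ x in box d, w x = 0) :
    ∫⁻ x in box d, ‖w x‖ₑ ^ 2 ≤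
      ENNReal.ofReal (2 * π) ^ 2 * ∫⁻ x in box d, ‖fderiv ℝ w x‖ₑ ^ 2 := by
  obtain ⟨hV, hV0⟩ := aux_box_vol d
  set V := volume (box d) with hVdef
  set G := ∫⁻ x in box d, ‖fderiv ℝ w x‖ₑ ^ 2 with hG
  set R := ENNReal.ofReal (2 * π) with hR
  have hcw := hw.continuous
  have hcd : Continuous (fderiv ℝ w) := hw.continuous_fderiv (by norm_num)
  -- pointwise bound
  have h1 : ∀ x, V ^ 2 * ‖w x‖ₑ ^ 2 ≤ V * ∫⁻ h in box d, ‖w (h + x) - w x‖ₑ ^ 2 := by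
    intro x
    have e1 : ∫ y in box d, (w y - w x) = - (V.toReal • w x) := by
      rw [integral_sub (aux_integrable hcw) (aux_integrable continuous_const), h0]
      simp [hVdef, Measure.real]
    have e2 : V * ‖w x‖ₑ = ‖∫ y in box d, (w y - w x)‖ₑ := by
      rw [e1, enorm_neg, enorm_smul, Real.enorm_of_nonneg ENNReal.toReal_nonneg,
        ENNReal.ofReal_toReal hV]
    rw [← mul_pow, e2]
    calc _ ≤ (∫⁻ y in box d, ‖w y - w x‖ₑ) ^ 2 :=
          pow_le_pow_left' (enorm_integral_le_lintegral_enorm _) 2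
      _ ≤ V * ∫⁻ y in box d, ‖w y - w x‖ₑ ^ 2 := by
          refine (aux_cs1 _ (by fun_prop)).trans ?_
          simp [hVdef]
      _ = _ := by
          rw [← aux_shift (fun y => ‖w y - w x‖ₑ ^ 2) _ x]
          · simp only [add_comm x]
          · intro y i
            simp only [hp y i]
  have h2 : ∀ h ∈ box d, ∫⁻ x in box d, ‖w (h + x) - w x‖ₑ ^ 2 ≤ R ^ 2 * G := by
    intro h hh
    calc _ ≤ ∫⁻ x in box d, (‖h‖ₑ ^ 2 *
              ∫⁻ t in Set.Ioc (0:ℝ) 1, ‖fderiv ℝ w (t • h + x)‖ₑ ^ 2) :=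
          lintegral_mono fun x => aux_diff w hw x h
      _ = ‖h‖ₑ ^ 2 * ∫⁻ x in box d,
              ∫⁻ t in Set.Ioc (0:ℝ) 1, ‖fderiv ℝ w (t • h + x)‖ₑ ^ 2 := by
          rw [lintegral_const_mul' _ _ (by simp)]
      _ = ‖h‖ₑ ^ 2 * ∫⁻ t in Set.Ioc (0:ℝ) 1, ∫⁻ x in box d,
              ‖fderiv ℝ w (t • h + x)‖ₑ ^ 2 := by
          rw [lintegral_lintegral_swap]
          apply Measurable.aemeasurable
          apply Measurable.pow_const
          apply Continuous.measurable
          apply Continuous.enorm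
          exact hcd.comp (by fun_prop)
      _ = ‖h‖ₑ ^ 2 * ∫⁻ t in Set.Ioc (0:ℝ) 1, G := by
          congr 1
          refine lintegral_congr fun t => ?_
          refine aux_shift (fun x => ‖fderiv ℝ w x‖ₑ ^ 2) ?_ (t • h)
          intro y i
          simp only [aux_per_fderiv w hp y i]
      _ ≤ _ := by
          simp only [lintegral_const, MeasurableSet.univ, Measure.restrict_apply, Set.univ_inter,
            Real.volume_Ioc, sub_zero, ENNReal.ofReal_one, mul_one]
          gcongr
          exact aux_mem_box hh
  have h3 : V ^ 2 * ∫⁻ x in box d, ‖w x‖ₑ ^ 2 ≤ V ^ 2 * (R ^ 2 * G) := by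
    calc _ = ∫⁻ x in box d, V ^ 2 * ‖w x‖ₑ ^ 2 := by
          rw [lintegral_const_mul' _ _ (by simp [hV])]
      _ ≤ ∫⁻ x in box d, V * ∫⁻ h in box d, ‖w (h + x) - w x‖ₑ ^ 2 := lintegral_mono h1
      _ = V * ∫⁻ x in box d, ∫⁻ h in box d, ‖w (h + x) - w x‖ₑ ^ 2 := by
          rw [lintegral_const_mul' _ _ hV]
      _ = V * ∫⁻ h in box d, ∫⁻ x in box d, ‖w (h + x) - w x‖ₑ ^ 2 := by
          rw [lintegral_lintegral_swap]
          apply Measurable.aemeasurable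
          apply Measurable.pow_const
          apply Continuous.measurable
          apply Continuous.enorm
          exact (hcw.comp (by fun_prop)).sub (hcw.comp (by fun_prop))
      _ ≤ V * ∫⁻ h in box d, R ^ 2 * G := by
          gcongr 1
          exact setLIntegral_mono' (aux_box_meas d) h2
      _ = _ := by
          simp only [lintegral_const, MeasurableSet.univ, Measure.restrict_apply, Set.univ_inter]
          rw [← hVdef]; ring
  exact (ENNReal.mul_le_mul_iff_right (pow_ne_zero 2 hV0) (by simp [hV])).1 h3

theorem aux_cover {d : ℕ} (B : Set (Fin d → ℝ)) (hB : IsCompact B) :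
    ∃ n : ℕ, ∀ F : (Fin d → ℝ) → ℝ≥0∞, IsPer F →
      ∫⁻ x in B, F x ≤ n * ∫⁻ x in box d, F x := by
  have hp : 0 < π := Real.pi_pos
  have hopen : IsOpen (box d) := isOpen_set_pi Set.finite_univ fun _ _ => isOpen_Ioo
  obtain ⟨t, ht⟩ := hB.elim_finite_subcover (fun h : Fin d → ℝ => (fun x => -h + x) ⁻¹' box d)
    (fun h => hopen.preimage (by fun_prop)) (by
      intro x _
      refine Set.mem_iUnion.2 ⟨x - fun _ => π, ?_⟩
      intro i _
      simp [hp])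
  refine ⟨t.card, fun F hF => ?_⟩
  have key : ∀ h : Fin d → ℝ, ∫⁻ x in (fun x => -h + x) ⁻¹' box d, F x = ∫⁻ x in box d, F x := by
    intro h
    rw [← aux_shift F hF h]
    have := (measurePreserving_add_left (volume : Measure (Fin d → ℝ))
      (-h)).setLIntegral_comp_preimage_emb
      (measurableEmbedding_addLeft (-h)) (fun x => F (h + x)) (box d)
    rw [← this]
    simp
  calc _ ≤ ∫⁻ x in ⋃ i : t, (fun x => -(i : Fin d → ℝ) + x) ⁻¹' box d, F x := by
        refine lintegral_mono_set (ht.trans ?_)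
        rw [Set.iUnion_subtype]
    _ ≤ ∑' i : t, ∫⁻ x in (fun x => -(i : Fin d → ℝ) + x) ⁻¹' box d, F x :=
        lintegral_iUnion_le _ _
    _ = _ := by simp [key]

theorem aux_two {α E : Type*} [MeasurableSpace α] [NormedAddCommGroup E] (μ : Measure α)
    (f : α → E) : eLpNorm f 2 μ ^ 2 = ∫⁻ x, ‖f x‖ₑ ^ 2 ∂μ := by
  rw [eLpNorm_eq_lintegral_rpow_enorm_toReal (by norm_num) (by norm_num), ← ENNReal.rpow_natCast,
    ← ENNReal.rpow_mul]
  norm_num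

theorem aux_add_sq (a b : ℝ≥0∞) : (a + b) ^ 2 ≤ 4 * (a ^ 2 + b ^ 2) := by
  rcases le_total a b with h | h
  · calc (a + b) ^ 2 ≤ (b + b) ^ 2 := by gcongr
      _ = 4 * b ^ 2 := by ring
      _ ≤ _ := by gcongr; exact le_add_self
  · calc (a + b) ^ 2 ≤ (a + a) ^ 2 := by gcongr
      _ = 4 * a ^ 2 := by ring
      _ ≤ _ := by gcongr; exact le_self_add

theorem aux_sobolev (d : ℕ) (hd : d = 2 ∨ d = 3) :
    ∃ C : ℝ≥0∞, C ≠ ∞ ∧ ∀ w : (Fin d → ℝ) → (Fin d → ℝ), ContDiff ℝ 1 w → IsPer w →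
      (∫ x in box d, w x = 0) →
      (eLpNorm w 4 (volume.restrict (box d))) ^ 2 ≤
        C * ∫⁻ x in box d, ‖fderiv ℝ w x‖ₑ ^ 2 := by
  have hpi : 0 < π := Real.pi_pos
  let c : Fin d → ℝ := fun _ => π
  let η : ContDiffBump c := ⟨π, 2 * π, hpi, by linarith⟩
  let B := Metric.closedBall c (2 * π)
  have hB : IsCompact B := isCompact_closedBall _ _
  have hBm : MeasurableSet B := hB.measurableSet
  obtain ⟨n, hn⟩ := aux_cover B hB
  have hη : ContDiff ℝ 1 η := η.contDiff
  have hηc : Continuous (fderiv ℝ η) := hη.continuous_fderiv (by norm_num)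
  obtain ⟨M, hM⟩ := hB.exists_bound_of_continuousOn hηc.continuousOn
  have hsub : box d ⊆ Metric.closedBall c π := by
    intro x hx
    rw [Metric.mem_closedBall, dist_pi_le_iff hpi.le]
    intro i
    have := hx i trivial
    rw [Real.dist_eq, abs_le]
    simp only [c]
    constructor <;> linarith [this.1, this.2]
  let p : ℝ≥0 := 9 / 5
  let K : ℝ≥0∞ := eLpNormLESNormFDerivOfLeConst (Fin d → ℝ)
    (volume : Measure (Fin d → ℝ)) B p 4
  let r : ℝ := 1 / (p : ℝ≥0∞).toReal - 1 / (2 : ℝ≥0∞).toReal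
  let V : ℝ≥0∞ := volume B ^ r
  have hr : 0 ≤ r := by simp [r, p]; norm_num
  have hV : V ≠ ∞ := ENNReal.rpow_ne_top_of_nonneg hr hB.measure_lt_top.ne
  let R := ENNReal.ofReal (2 * π)
  let M' := ENNReal.ofReal M
  refine ⟨(K * V) ^ 2 * (n * (4 * (1 + M' ^ 2 * R ^ 2))), ?_, ?_⟩
  · have : R ≠ ∞ := ENNReal.ofReal_ne_top
    have : M' ≠ ∞ := ENNReal.ofReal_ne_top
    have : K ≠ ∞ := ENNReal.coe_ne_top
    finiteness
  intro w hw hp h0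
  have hcw := hw.continuous
  have hcd : Continuous (fderiv ℝ w) := hw.continuous_fderiv (by norm_num)
  have hpd := aux_per_fderiv w hp
  let v : (Fin d → ℝ) → (Fin d → ℝ) := fun x => η x • w x
  have hv : ContDiff ℝ 1 v := hη.smul hw
  have hvB : Function.support v ⊆ B := by
    intro x hx
    have : x ∈ Function.support η := fun h => hx (by simp [v, h])
    rw [η.support_eq] at this
    exact Metric.ball_subset_closedBall this
  have hvB' : Function.support (fderiv ℝ v) ⊆ B :=
    (support_fderiv_subset ℝ).trans (closure_minimal hvB hB.isClosed)
  have hcv : Continuous (fderiv ℝ v) := hv.continuous_fderiv (by norm_num)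
  have hbd : ∀ x ∈ B, ‖fderiv ℝ v x‖ₑ ^ 2 ≤
      4 * (‖fderiv ℝ w x‖ₑ ^ 2 + M' ^ 2 * ‖w x‖ₑ ^ 2) := by
    intro x hx
    have e : fderiv ℝ v x = η x • fderiv ℝ w x + (fderiv ℝ η x).smulRight (w x) :=
      fderiv_fun_smul (hη.differentiable (by norm_num) x) (hw.differentiable (by norm_num) x)
    rw [e, ← mul_pow]
    refine le_trans ?_ (aux_add_sq _ _)
    gcongr
    refine (enorm_add_le (η x • fderiv ℝ w x) ((fderiv ℝ η x).smulRight (w x))).trans ?_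
    gcongr
    · rw [enorm_smul]
      refine mul_le_of_le_one_left' ?_
      rw [Real.enorm_of_nonneg η.nonneg]
      exact ENNReal.ofReal_le_one.2 η.le_one
    · rw [← ofReal_norm, ContinuousLinearMap.norm_smulRight_apply,
        ENNReal.ofReal_mul (norm_nonneg _), ofReal_norm (w x)]
      gcongr
      exact ENNReal.ofReal_le_ofReal (hM x hx)
  have h1 : eLpNorm w 4 (volume.restrict (box d)) ≤
      K * V * eLpNorm (fderiv ℝ v) 2 (volume.restrict B) := by
    calc _ = eLpNorm v 4 (volume.restrict (box d)) := by
          refine eLpNorm_congr_ae ?_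
          filter_upwards [ae_restrict_mem (aux_box_meas d)] with x hx
          have : η x = 1 := η.one_of_mem_closedBall (hsub hx)
          simp [v, this]
      _ ≤ eLpNorm v 4 volume := eLpNorm_mono_measure _ Measure.restrict_le_self
      _ ≤ K * eLpNorm (fderiv ℝ v) p volume := by
          have := eLpNorm_le_eLpNorm_fderiv_of_le (volume : Measure (Fin d → ℝ)) hv hvB
            (p := p) (q := 4) ?_ ?_ ?_ hB.isBounded
          · exact this
          · rw [← NNReal.coe_le_coe]; simp only [p]; norm_num
          · rw [← NNReal.coe_lt_coe]
            rcases hd with rfl | rfl <;> simp [p] <;> norm_num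
          · rcases hd with rfl | rfl <;> simp [p] <;> norm_num
      _ = K * eLpNorm (fderiv ℝ v) p (volume.restrict B) := by
          rw [eLpNorm_restrict_eq_of_support_subset (ε := (Fin d → ℝ) →L[ℝ] (Fin d → ℝ)) hvB']
      _ ≤ K * (eLpNorm (fderiv ℝ v) 2 (volume.restrict B) * V) := by
          gcongr
          have := eLpNorm_le_eLpNorm_mul_rpow_measure_univ (μ := volume.restrict B)
            (p := (p : ℝ≥0∞)) (q := 2) (f := fderiv ℝ v) ?_ hcv.aestronglyMeasurable
          · rw [Measure.restrict_apply_univ] at this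
            exact this
          · have : p ≤ 2 := by rw [← NNReal.coe_le_coe]; simp only [p]; norm_num
            exact_mod_cast this
      _ = _ := by ring
  have h2 : ∫⁻ x in B, ‖fderiv ℝ v x‖ₑ ^ 2 ≤
      (n * (4 * (1 + M' ^ 2 * R ^ 2))) * ∫⁻ x in box d, ‖fderiv ℝ w x‖ₑ ^ 2 := by
    calc _ ≤ ∫⁻ x in B, 4 * (‖fderiv ℝ w x‖ₑ ^ 2 + M' ^ 2 * ‖w x‖ₑ ^ 2) :=
          setLIntegral_mono' hBm hbd
      _ ≤ n * ∫⁻ x in box d, 4 * (‖fderiv ℝ w x‖ₑ ^ 2 + M' ^ 2 * ‖w x‖ₑ ^ 2) := by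
          apply hn
          intro x i
          simp only [hp x i, hpd x i]
      _ = n * (4 * ((∫⁻ x in box d, ‖fderiv ℝ w x‖ₑ ^ 2) +
            M' ^ 2 * ∫⁻ x in box d, ‖w x‖ₑ ^ 2)) := by
          rw [lintegral_const_mul' _ _ (by norm_num), lintegral_add_left (by fun_prop),
            lintegral_const_mul' _ _ (by simp [M'])]
      _ ≤ n * (4 * ((∫⁻ x in box d, ‖fderiv ℝ w x‖ₑ ^ 2) +
            M' ^ 2 * (R ^ 2 * ∫⁻ x in box d, ‖fderiv ℝ w x‖ₑ ^ 2))) := by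
          gcongr
          exact aux_poincare w hw hp h0
      _ = _ := by ring
  calc _ ≤ (K * V * eLpNorm (fderiv ℝ v) 2 (volume.restrict B)) ^ 2 := pow_le_pow_left' h1 2
    _ = (K * V) ^ 2 * ∫⁻ x in B, ‖fderiv ℝ v x‖ₑ ^ 2 := by rw [mul_pow, aux_two]
    _ ≤ _ := by
      rw [mul_assoc]
      gcongr

theorem aux_entry {d : ℕ} (M : Fin d → Fin d → ℝ) (i j : Fin d) : |M i j| ≤ frob M := by
  rw [frob]
  apply Real.abs_le_sqrt
  calc M i j ^ 2 ≤ ∑ j, M i j ^ 2 :=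
        Finset.single_le_sum (f := fun j => M i j ^ 2) (fun _ _ => sq_nonneg _) (Finset.mem_univ j)
    _ ≤ _ := Finset.single_le_sum (f := fun i => ∑ j, M i j ^ 2)
        (fun _ _ => Finset.sum_nonneg fun _ _ => sq_nonneg _) (Finset.mem_univ i)

theorem aux_pd {d : ℕ} {w : (Fin d → ℝ) → (Fin d → ℝ)} (hw : ContDiff ℝ 1 w)
    (x : Fin d → ℝ) (i j : Fin d) :
    pd (fun y => w y i) j x = fderiv ℝ w x (Pi.single j 1) i := by
  have h := (hasFDerivAt_pi'.1 (hw.differentiable (by norm_num) x).hasFDerivAt i).fderiv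
  rw [pd, h]
  rfl

theorem aux_op {d : ℕ} {w : (Fin d → ℝ) → (Fin d → ℝ)} (hw : ContDiff ℝ 1 w) (x : Fin d → ℝ) :
    ‖fderiv ℝ w x‖ ≤ d * frob (gradM w x) := by
  have hf : 0 ≤ frob (gradM w x) := Real.sqrt_nonneg _
  refine ContinuousLinearMap.opNorm_le_bound _ (by positivity) fun v => ?_
  rw [pi_norm_le_iff_of_nonneg (by positivity)]
  intro i
  have e : fderiv ℝ w x v i = ∑ j, v j * gradM w x i j := by
    have : v = ∑ j, v j • (Pi.single j (1:ℝ) : Fin d → ℝ) := by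
      funext k
      simp [Finset.sum_apply, Pi.single_apply]
    conv_lhs => rw [this]
    rw [map_sum, Finset.sum_apply]
    refine Finset.sum_congr rfl fun j _ => ?_
    rw [map_smul, Pi.smul_apply, smul_eq_mul, gradM, aux_pd hw]
  rw [e]
  refine (norm_sum_le _ _).trans ?_
  calc _ ≤ ∑ j : Fin d, ‖v‖ * frob (gradM w x) := by
        refine Finset.sum_le_sum fun j _ => ?_
        rw [norm_mul]
        exact mul_le_mul (norm_le_pi_norm v j) (aux_entry _ i j) (norm_nonneg _) (norm_nonneg _)
    _ = _ := by simp; ring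

theorem aux_frob_cont {d : ℕ} {w : (Fin d → ℝ) → (Fin d → ℝ)} (hw : ContDiff ℝ 1 w) :
    Continuous fun x => frob (gradM w x) := by
  have hcd : Continuous (fderiv ℝ w) := hw.continuous_fderiv (by norm_num)
  simp only [frob, gradM, aux_pd hw]
  fun_prop

theorem aux_int_frob {d : ℕ} {w : (Fin d → ℝ) → (Fin d → ℝ)} (hw : ContDiff ℝ 1 w) :
    ∫⁻ x in box d, ‖frob (gradM w x)‖ₑ ^ 2 =
      ENNReal.ofReal (∫ x in box d, frob (gradM w x) ^ 2) := by
  have hi : IntegrableOn (fun x => frob (gradM w x) ^ 2) (box d) volume :=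
    aux_integrable ((aux_frob_cont hw).pow 2)
  rw [ofReal_integral_eq_lintegral_ofReal hi
    (Filter.Eventually.of_forall fun x => sq_nonneg _)]
  refine lintegral_congr fun x => ?_
  have hf : 0 ≤ frob (gradM w x) := Real.sqrt_nonneg _
  rw [Real.enorm_of_nonneg hf, ENNReal.ofReal_pow hf]

/-- `|∫_Ω ((w·∇)u) · w| ≤ c ‖∇u‖_{L²} ‖∇w‖²_{L²}`. -/
theorem stmt_16 (d : ℕ) (hd : d = 2 ∨ d = 3) :
    ∃ c > 0, ∀ u w : (Fin d → ℝ) → (Fin d → ℝ),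
      ContDiff ℝ (⊤ : ℕ∞) u → IsPer u → ContDiff ℝ (⊤ : ℕ∞) w → IsPer w →
      (∫ x in box d, w x) = 0 →
      |∫ x in box d, ∑ i, (∑ j, w x j * pd (fun y => u y i) j x) * w x i|
        ≤ c * Real.sqrt (∫ x in box d, frob (gradM u x) ^ 2)
            * ∫ x in box d, frob (gradM w x) ^ 2 := by
  obtain ⟨C, hC, hS⟩ := aux_sobolev d hd
  have hd0 : 0 < (d : ℝ) := by rcases hd with rfl | rfl <;> norm_num
  refine ⟨(d ^ 2 : ℝ) * (C.toReal + 1) * d ^ 2, by positivity, ?_⟩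
  intro u w hu _ hw hpw h0
  replace hu : ContDiff ℝ 1 u := hu.of_le (by exact_mod_cast le_top)
  replace hw : ContDiff ℝ 1 w := hw.of_le (by exact_mod_cast le_top)
  set U := ∫ x in box d, frob (gradM u x) ^ 2 with hU
  set W := ∫ x in box d, frob (gradM w x) ^ 2 with hW
  have hU0 : 0 ≤ U := integral_nonneg fun x => sq_nonneg _
  have hW0 : 0 ≤ W := integral_nonneg fun x => sq_nonneg _
  have hcw := hw.continuous
  have hcu := aux_frob_cont hu
  have hpt : ∀ x, ‖∑ i, (∑ j, w x j * pd (fun y => u y i) j x) * w x i‖ₑ ≤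
      ENNReal.ofReal (d ^ 2) * (‖w x‖ₑ ^ 2 * ‖frob (gradM u x)‖ₑ) := by
    intro x
    have hf : 0 ≤ frob (gradM u x) := Real.sqrt_nonneg _
    have : ‖∑ i, (∑ j, w x j * pd (fun y => u y i) j x) * w x i‖ ≤
        d ^ 2 * (‖w x‖ ^ 2 * ‖frob (gradM u x)‖) := by
      rw [Real.norm_of_nonneg hf]
      calc _ ≤ ∑ i : Fin d, (∑ j : Fin d, ‖w x‖ * frob (gradM u x)) * ‖w x‖ := by
            refine (norm_sum_le _ _).trans (Finset.sum_le_sum fun i _ => ?_)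
            rw [norm_mul]
            refine mul_le_mul ?_ (norm_le_pi_norm (w x) i) (norm_nonneg _) (by positivity)
            refine (norm_sum_le _ _).trans (Finset.sum_le_sum fun j _ => ?_)
            rw [norm_mul]
            exact mul_le_mul (norm_le_pi_norm (w x) j) (aux_entry (gradM u x) i j)
              (norm_nonneg _) (norm_nonneg _)
        _ = _ := by simp; ring
    rw [← ofReal_norm, ← ofReal_norm (w x), ← ofReal_norm (frob (gradM u x)),
      ← ENNReal.ofReal_pow (norm_nonneg _), ← ENNReal.ofReal_mul (by positivity),
      ← ENNReal.ofReal_mul (by positivity)]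
    exact ENNReal.ofReal_le_ofReal this
  have h4 : ∫⁻ x in box d, (‖w x‖ₑ ^ 2) ^ 2 = (eLpNorm w 4 (volume.restrict (box d)) ^ 2) ^ 2 := by
    rw [eLpNorm_eq_lintegral_rpow_enorm_toReal (by norm_num) (by norm_num), ← pow_mul,
      ← ENNReal.rpow_natCast, ← ENNReal.rpow_mul]
    norm_num
    refine lintegral_congr fun x => ?_
    rw [← pow_mul]
  have hG : ∫⁻ x in box d, ‖fderiv ℝ w x‖ₑ ^ 2 ≤ ENNReal.ofReal (d ^ 2 * W) := by
    rw [ENNReal.ofReal_mul (by positivity), hW, ← aux_int_frob hw,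
      ← lintegral_const_mul' _ _ ENNReal.ofReal_ne_top]
    refine lintegral_mono fun x => ?_
    simp only []
    rw [ENNReal.ofReal_pow hd0.le, ← mul_pow, ← ofReal_norm, ← ofReal_norm (frob _),
      ← ENNReal.ofReal_mul hd0.le]
    gcongr
    refine (aux_op hw x).trans ?_
    gcongr
    exact le_abs_self _
  have hcs : ∫⁻ x in box d, ‖w x‖ₑ ^ 2 * ‖frob (gradM u x)‖ₑ ≤
      ENNReal.ofReal (C.toReal * (d ^ 2 * W) * √U) := by
    have h := aux_cs (volume.restrict (box d)) (f := fun x => ‖w x‖ₑ ^ 2)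
      (g := fun x => ‖frob (gradM u x)‖ₑ) (by fun_prop)
      hcu.enorm.measurable.aemeasurable
    rw [h4, aux_int_frob hu, ← hU] at h
    have h5 : eLpNorm w 4 (volume.restrict (box d)) ^ 2 ≤
        ENNReal.ofReal (C.toReal * (d ^ 2 * W)) := by
      rw [ENNReal.ofReal_mul ENNReal.toReal_nonneg, ENNReal.ofReal_toReal hC]
      exact (hS w hw hpw h0).trans (by gcongr)
    rw [← ENNReal.pow_le_pow_left_iff two_ne_zero]
    refine h.trans ?_
    rw [ENNReal.ofReal_mul (by positivity), mul_pow, ← ENNReal.ofReal_pow (Real.sqrt_nonneg _),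
      Real.sq_sqrt hU0]
    gcongr
  have hfin : ‖∫ x in box d, ∑ i, (∑ j, w x j * pd (fun y => u y i) j x) * w x i‖ₑ ≤
      ENNReal.ofReal (d ^ 2 * (C.toReal * (d ^ 2 * W) * √U)) := by
    refine (enorm_integral_le_lintegral_enorm _).trans ?_
    refine (lintegral_mono hpt).trans ?_
    rw [lintegral_const_mul' _ _ ENNReal.ofReal_ne_top, ENNReal.ofReal_mul (by positivity)]
    gcongr
  rw [← ofReal_norm, ENNReal.ofReal_le_ofReal_iff (by positivity), Real.norm_eq_abs] at hfin
  refine hfin.trans ?_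
  calc _ = (d ^ 2 : ℝ) * C.toReal * d ^ 2 * √U * W := by ring
    _ ≤ _ := by gcongr; linarith
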